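/- arXiv:math/9908076 — 2 statements merged into one kernel-verified Lean document; each statement's English description precedes it below -/
import Mathlib

section
/- Every compact Hausdorff abelian topological group which, as a topological space, is simply connected and an AE(1)-compactum consists of a single element. -/
open Topology

universe u

/-- A topological space `Z` has Lebesgue covering dimension at most `n`:
every finite open cover admits a finite open refinement in which each point
lies in at most `n + 1` members. -/
def CovDimLE (Z : Type u) [TopologicalSpace Z] (n : ℕ) : Prop :=
  ∀ 𝒰 : Finset (Set Z), (∀ U ∈ 𝒰, IsOpen U) → ⋃₀ (𝒰 : Set (Set Z)) = Set.univ →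
    ∃ 𝒱 : Finset (Set Z), (∀ V ∈ 𝒱, IsOpen V) ∧ ⋃₀ (𝒱 : Set (Set Z)) = Set.univ ∧
      (∀ V ∈ 𝒱, ∃ U ∈ 𝒰, V ⊆ U) ∧
      ∀ z : Z, Nat.card {V : Set Z // V ∈ 𝒱 ∧ z ∈ V} ≤ n + 1

/-- `X` is an absolute extensor in dimension `n` (an AE(n)-space): every continuous map
into `X` from a closed subspace of a compact Hausdorff space of covering dimension
at most `n` extends continuously over the whole space. -/
def IsAE (n : ℕ) (X : Type u) [TopologicalSpace X] : Prop :=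
  ∀ (Z : Type u) [TopologicalSpace Z], CompactSpace Z → T2Space Z → CovDimLE Z n →
    ∀ Z₀ : Set Z, IsClosed Z₀ → ∀ g₀ : C(Z₀, X),
      ∃ g : C(Z, X), ∀ z : Z₀, g (z : Z) = g₀ z

/-- `X` is an absolute neighborhood extensor in dimension `4` (an ANE(4)-space):
every continuous map into `X` from a closed subspace `Z₀` of a compact Hausdorff
space of covering dimension at most `4` extends continuously over some open
neighborhood of `Z₀`. -/
def IsANE4 (X : Type u) [TopologicalSpace X] : Prop :=
  ∀ (Z : Type u) [TopologicalSpace Z], CompactSpace Z → T2Space Z → CovDimLE Z 4 →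
    ∀ Z₀ : Set Z, IsClosed Z₀ → ∀ g₀ : C(Z₀, X),
      ∃ (U : Set Z) (_ : IsOpen U) (hZ₀U : Z₀ ⊆ U) (g : C(U, X)),
        ∀ (z : Z) (hz : z ∈ Z₀), g ⟨z, hZ₀U hz⟩ = g₀ ⟨z, hz⟩

/-- The underlying space of `X` is a topological manifold: every point has an open
neighborhood homeomorphic to an open subset of some Euclidean space. -/
def IsTopManifold (X : Type u) [TopologicalSpace X] : Prop :=
  ∀ x : X, ∃ (n : ℕ) (U : Set X) (V : Set (EuclideanSpace ℝ (Fin n))),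
    IsOpen U ∧ x ∈ U ∧ IsOpen V ∧ Nonempty (U ≃ₜ V)

/-- The multiplicative equivalence `e` is an isomorphism of topological groups,
i.e. it is continuous with continuous inverse. -/
def IsTopGroupIso {G H : Type*} [Group G] [Group H] [TopologicalSpace G]
    [TopologicalSpace H] (e : G ≃* H) : Prop :=
  Continuous e ∧ Continuous e.symm

/-- A package consisting of a compact Hausdorff topological group. -/
structure CompactGroupPkg : Type (u + 1) where
  carrier : Type u
  [topology : TopologicalSpace carrier]
  [group : Group carrier]
  [topGroup : IsTopologicalGroup carrier]
  [compact : CompactSpace carrier]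
  [t2 : T2Space carrier]

attribute [instance] CompactGroupPkg.topology CompactGroupPkg.group
  CompactGroupPkg.topGroup CompactGroupPkg.compact CompactGroupPkg.t2

/-- `L` is a simple, connected and simply connected compact Lie group: a compact
Hausdorff topological group whose underlying space is a topological manifold,
which is connected, simply connected, nonabelian, and all of whose closed
normal subgroups other than the whole group are finite. -/
def IsSimpleSCSCLieGroup (L : CompactGroupPkg.{u}) : Prop :=
  IsTopManifold L.carrier ∧ ConnectedSpace L.carrier ∧ SimplyConnectedSpace L.carrier ∧
    (∃ a b : L.carrier, a * b ≠ b * a) ∧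
    ∀ N : Subgroup L.carrier, N.Normal → IsClosed (N : Set L.carrier) → N ≠ ⊤ → Finite N

theorem covDimLE_one_prod_unitInterval (P : Type u) [TopologicalSpace P] [CompactSpace P]
    [T2Space P] [TotallyDisconnectedSpace P] : CovDimLE (P × unitInterval) 1 := by
  classical
  intro 𝒰 hUo hUc
  let J (n i : ℕ) : Set unitInterval := {t | |(n : ℝ) * t - i| < 1}
  have hJo (n i : ℕ) : IsOpen (J n i) :=
    isOpen_lt (by fun_prop) continuous_const
  -- locally in `P`, some equidistant interval cover refines `𝒰`
  have hloc (p : P) : ∃ n : ℕ, ∃ O : Set P, IsOpen O ∧ p ∈ O ∧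
      ∀ i ∈ Finset.range (n + 1), ∃ U ∈ 𝒰, O ×ˢ J n i ⊆ U := by
    obtain ⟨δ, hδ, hball⟩ := lebesgue_number_lemma_of_metric
      (c := fun U : 𝒰 ↦ {t : unitInterval | (p, t) ∈ (U : Set (P × unitInterval))})
      isCompact_univ (fun U ↦ (hUo U U.2).preimage (by fun_prop)) (fun t _ ↦ by
        have : (p, t) ∈ ⋃₀ (𝒰 : Set (Set (P × unitInterval))) := hUc ▸ Set.mem_univ _
        obtain ⟨U, hU, ht⟩ := this
        exact Set.mem_iUnion.2 ⟨⟨U, hU⟩, ht⟩)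
    obtain ⟨m, hm⟩ := exists_nat_one_div_lt hδ
    have key : ∀ i ∈ Finset.range (m + 1 + 1), ∃ U ∈ 𝒰,
        ∀ᶠ p' in 𝓝 p, ∀ t ∈ J (m + 1) i, (p', t) ∈ U := by
      intro i hi
      have hm0 : (0 : ℝ) < m + 1 := by positivity
      have hi' : (i : ℝ) ≤ m + 1 := by
        exact_mod_cast Nat.lt_succ_iff.1 (Finset.mem_range.1 hi)
      let c : unitInterval := ⟨i / (m + 1), by positivity, by rw [div_le_one hm0]; exact hi'⟩
      obtain ⟨U, hU⟩ := hball c (Set.mem_univ _)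
      refine ⟨U, U.2, ?_⟩
      have hK : IsCompact {t : unitInterval | |((m + 1 : ℕ) : ℝ) * t - i| ≤ 1} :=
        (isClosed_le (by fun_prop) continuous_const).isCompact
      have := hK.eventually_forall_of_forall_eventually (x₀ := p)
        (P := fun p' t ↦ (p', t) ∈ (U : Set (P × unitInterval))) (fun t ht ↦ by
          refine (hUo U U.2).mem_nhds (hU ?_)
          rw [Metric.mem_ball, Subtype.dist_eq, Real.dist_eq]
          refine lt_of_le_of_lt ?_ hm
          have hc : ((t : ℝ) - c) * (m + 1) = (m + 1 : ℕ) * t - i := by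
            rw [show (c : ℝ) = i / (m + 1) from rfl]
            push_cast
            field_simp
          rw [le_div_iff₀ hm0, show |(t : ℝ) - c| * (m + 1) = |((t : ℝ) - c) * (m + 1)| by
            rw [abs_mul, abs_of_pos hm0], hc]
          exact ht)
      filter_upwards [this] with p' hp' t ht using hp' t (le_of_lt ht)
    choose! U hU hUp using key
    have := (Filter.eventually_all_finset _).2 hUp
    obtain ⟨O, hO, hOo, hpO⟩ := eventually_nhds_iff.1 this
    exact ⟨m + 1, O, hOo, hpO, fun i hi ↦ ⟨U i, hU i hi, fun x hx ↦ hO x.1 hx.1 i hi x.2 hx.2⟩⟩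
  choose n O hOo hpO hO using hloc
  have hcov : TopologicalSpace.IsOpenCover fun p ↦ (⟨O p, hOo p⟩ : TopologicalSpace.Opens P) :=
    .mk (by ext x; simpa using ⟨x, hpO x⟩)
  obtain ⟨k, W, hW, hWc, hWd⟩ := hcov.exists_finite_nonempty_disjoint_clopen_cover
  choose p hp using fun j ↦ (hW j).2
  let V (j : Fin k) (i : ℕ) : Set (P × unitInterval) := (W j : Set P) ×ˢ J (n (p j)) i
  refine ⟨Finset.univ.biUnion fun j ↦ (Finset.range (n (p j) + 1)).image (V j), ?_, ?_, ?_, ?_⟩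
  · simp only [Finset.mem_biUnion, Finset.mem_image]
    rintro _ ⟨j, -, i, -, rfl⟩
    exact (W j).isClopen.isOpen.prod (hJo _ _)
  · refine Set.eq_univ_of_forall fun z ↦ ?_
    obtain ⟨j, hj⟩ := Set.mem_iUnion.1 (hWc (Set.mem_univ z.1))
    have h0 : 0 ≤ (n (p j) : ℝ) * z.2 := mul_nonneg (Nat.cast_nonneg _) z.2.2.1
    refine ⟨V j ⌊(n (p j) : ℝ) * z.2⌋₊, ?_, hj, ?_⟩
    · simp only [Finset.coe_biUnion, Finset.coe_image, Set.mem_iUnion]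
      refine ⟨j, by simp, _, ?_, rfl⟩
      rw [Finset.mem_coe, Finset.mem_range, Nat.lt_succ_iff]
      exact Nat.floor_le_of_le (mul_le_of_le_one_right (Nat.cast_nonneg _) z.2.2.2)
    · have h1 := Nat.floor_le h0
      have h2 := Nat.lt_floor_add_one ((n (p j) : ℝ) * z.2)
      simp only [J, Set.mem_ofPred_eq, abs_lt]
      constructor <;> linarith
  · simp only [Finset.mem_biUnion, Finset.mem_image]
    rintro _ ⟨j, -, i, hi, rfl⟩
    obtain ⟨U, hU, hUs⟩ := hO (p j) i hi
    exact ⟨U, hU, (Set.prod_mono (hp j) subset_rfl).trans hUs⟩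
  · intro z
    obtain ⟨j, hj⟩ := Set.mem_iUnion.1 (hWc (Set.mem_univ z.1))
    have h0 : 0 ≤ (n (p j) : ℝ) * z.2 := mul_nonneg (Nat.cast_nonneg _) z.2.2.1
    set a := ⌊(n (p j) : ℝ) * z.2⌋₊ with ha
    have hsub : {S | S ∈ Finset.univ.biUnion
        (fun j ↦ (Finset.range (n (p j) + 1)).image (V j)) ∧ z ∈ S} ⊆
        (({V j a, V j (a + 1)} : Finset (Set (P × unitInterval))) : Set _) := by
      rintro S ⟨hS, hz⟩
      simp only [Finset.mem_biUnion, Finset.mem_image] at hS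
      obtain ⟨j', -, i, hi, rfl⟩ := hS
      obtain rfl : j' = j := by
        by_contra hne
        have := hWd hne
        rw [Function.onFun, ← TopologicalSpace.Clopens.coe_disjoint] at this
        exact Set.disjoint_left.1 this hz.1 hj
      have hzi : |(n (p j') : ℝ) * z.2 - i| < 1 := hz.2
      rw [abs_lt] at hzi
      have h1 : a ≤ i := by
        have h := Nat.floor_le h0
        rw [← ha] at h
        have : (a : ℝ) < i + 1 := by linarith
        exact Nat.lt_succ_iff.1 (by exact_mod_cast this)
      have h2 : i ≤ a + 1 := by
        have h := Nat.lt_floor_add_one ((n (p j') : ℝ) * z.2)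
        rw [← ha] at h
        have : (i : ℝ) < a + 1 + 1 := by linarith
        exact Nat.lt_succ_iff.1 (by exact_mod_cast this)
      obtain rfl | rfl : i = a ∨ i = a + 1 := by omega
      · simp
      · simp
    calc Nat.card {S : Set (P × unitInterval) // _} ≤ Nat.card
          (({V j a, V j (a + 1)} : Finset (Set (P × unitInterval))) : Set _) :=
        Nat.card_mono (Finset.finite_toSet _) hsub
      _ ≤ 1 + 1 := by
        rw [Nat.card_coe_set_eq, Set.ncard_coe_finset]
        exact Finset.card_le_two

/-- The lifting criterion for simply connected compacta, with local path-connectedness replaced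
by the `AE(1)` property. -/
theorem IsCoveringMap.exists_lift_of_isAE_one {X : Type u} [TopologicalSpace X] [CompactSpace X]
    [T2Space X] [SimplyConnectedSpace X] (hae : IsAE 1 X) {E B : Type*} [TopologicalSpace E]
    [TopologicalSpace B] {p : E → B} (cov : IsCoveringMap p) (f : C(X, B)) {x₀ : X} {e₀ : E}
    (he : p e₀ = f x₀) : ∃ F : C(X, E), F x₀ = e₀ ∧ ∀ x, p (F x) = f x := by
  classical
  let π : Ultrafilter X → X := Ultrafilter.extend id
  have hπ : Continuous π := continuous_ultrafilter_extend id
  have hπs : Function.Surjective π := fun x ↦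
    ⟨pure x, congr_fun (ultrafilter_extend_extends (id : X → X)) x⟩
  let Z₀ : Set (Ultrafilter X × unitInterval) := {z | z.2 = 0 ∨ z.2 = 1}
  have hZ₀ : IsClosed Z₀ :=
    (isClosed_eq continuous_snd continuous_const).union (isClosed_eq continuous_snd continuous_const)
  have hclopen : IsClopen {z : Z₀ | z.1.2 = 0} := by
    refine ⟨isClosed_eq (by fun_prop) (by fun_prop), ?_⟩
    have : {z : Z₀ | z.1.2 = 0} = {z : Z₀ | z.1.2 = 1}ᶜ := by
      ext ⟨z, hz | hz⟩ <;> simp [hz]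
    rw [this]
    exact (isClosed_eq (by fun_prop) (by fun_prop)).isOpen_compl
  let g₀ : C(Z₀, X) := ⟨fun z ↦ if z.1.2 = 0 then x₀ else π z.1.1,
    continuous_const.if (fun z hz ↦ by simp [hclopen.frontier_eq] at hz) (by fun_prop)⟩
  obtain ⟨g, hg⟩ := hae _ inferInstance inferInstance (covDimLE_one_prod_unitInterval _) Z₀ hZ₀ g₀
  have hg0 (q : Ultrafilter X) : g (q, 0) = x₀ := by
    simpa [g₀] using hg ⟨(q, 0), Or.inl rfl⟩
  have hg1 (q : Ultrafilter X) : g (q, 1) = π q := by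
    simpa [g₀] using hg ⟨(q, 1), Or.inr rfl⟩
  let γ (q : Ultrafilter X) : Path x₀ (π q) :=
    ⟨⟨fun t ↦ g (q, t), by fun_prop⟩, hg0 q, hg1 q⟩
  let H : C(unitInterval × Ultrafilter X, B) := ⟨fun z ↦ f (g (z.2, z.1)), by fun_prop⟩
  have hH (q : Ultrafilter X) : H (0, q) = p (ContinuousMap.const _ e₀ q) := by
    simp [H, hg0, he]
  let L := cov.liftHomotopy H (.const _ e₀) hH
  have hL (q : Ultrafilter X) {x : X} (η : Path x₀ x) (hx : π q = x) :
      L (1, q) = cov.liftPath (f.comp η.toContinuousMap) e₀ (by simp [he]) 1 := by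
    subst hx
    rw [IsCoveringMap.liftHomotopy_apply]
    refine cov.liftPath_apply_one_eq_of_homotopicRel ?_ _ _ _
    exact ContinuousMap.HomotopicRel.comp_continuousMap
      (SimplyConnectedSpace.paths_homotopic (γ q) η) f
  have hquot : IsQuotientMap (⟨π, hπ⟩ : C(Ultrafilter X, X)) := hπ.isClosedMap.isQuotientMap hπ hπs
  let L₁ : C(Ultrafilter X, E) := ⟨fun q ↦ L (1, q), by fun_prop⟩
  have hfac : Function.FactorsThrough L₁ π := fun q q' h ↦
    (hL q (γ q') h).trans (hL q' (γ q') rfl).symm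
  let F : C(X, E) := hquot.lift L₁ hfac
  have hF (q : Ultrafilter X) : F (π q) = L (1, q) := DFunLike.congr_fun (hquot.lift_comp L₁ hfac) q
  refine ⟨F, ?_, fun x ↦ ?_⟩
  · obtain ⟨q, rfl⟩ := hπs x₀
    rw [hF, hL q (Path.refl _) rfl]
    have : f.comp (Path.refl (π q)).toContinuousMap = ContinuousMap.const _ (f (π q)) := rfl
    simp only [this]
    rw [cov.liftPath_const he.symm]
    rfl
  · obtain ⟨q, rfl⟩ := hπs x
    rw [hF]
    exact (congr_fun (cov.liftHomotopy_lifts H _ hH) (1, q)).trans (congr_arg f (hg1 q))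

/-- A compact topological group which is simply connected and an `AE(1)`-space has no nontrivial
continuous characters. -/
theorem continuousMonoidHom_circle_eq_one_of_isAE_one {G : Type u} [Group G] [TopologicalSpace G]
    [IsTopologicalGroup G] [CompactSpace G] [T2Space G] [SimplyConnectedSpace G]
    (hae : IsAE 1 G) (χ : G →ₜ* Circle) : χ = 1 := by
  obtain ⟨h, h1, hχ⟩ := Circle.isCoveringMap_exp.exists_lift_of_isAE_one hae
    (χ : C(G, Circle)) (x₀ := 1) (e₀ := 0) (by simp)
  replace hχ (x : G) : Circle.exp (h x) = χ x := hχ x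
  have hmul (x y : G) : h (x * y) = h x + h y := by
    have := Circle.isCoveringMap_exp.eq_of_comp_eq (g₁ := fun z : G × G ↦ h (z.1 * z.2))
      (g₂ := fun z ↦ h z.1 + h z.2) (by fun_prop) (by fun_prop)
      (by ext z; simp [Circle.exp_add, hχ]) (1, 1) (by simp [h1])
    exact congr_fun this (x, y)
  have hpow (x : G) (n : ℕ) : h (x ^ n) = n * h x := by
    induction n with
    | zero => simp [h1]
    | succ n ih => rw [pow_succ, hmul, ih]; push_cast; ring
  obtain ⟨C, hC⟩ := (isCompact_range h.continuous).isBounded.exists_norm_le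
  ext x
  have hx : h x = 0 := by
    by_contra hne
    obtain ⟨n, hn⟩ := exists_nat_gt (C / |h x|)
    have := hC (h (x ^ n)) ⟨_, rfl⟩
    rw [hpow, norm_mul, RCLike.norm_natCast, Real.norm_eq_abs] at this
    rw [div_lt_iff₀ (abs_pos.2 hne)] at hn
    linarith
  simp [← hχ, hx]

section Characters

open MeasureTheory

variable {G : Type*} [TopologicalSpace G] [CompactSpace G] {H : Type*} [NormedAddCommGroup H]

section

variable [InnerProductSpace ℂ H] [CompleteSpace H] [MeasurableSpace G] [BorelSpace G]
  (μ : Measure G) [IsFiniteMeasure μ] {U : G → unitary (H →L[ℂ] H)}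

theorem integrable_smul_unitary_apply (hU : ∀ v, Continuous fun x ↦ (U x : H →L[ℂ] H) v)
    (k : C(G, ℂ)) (v : H) :
    Integrable (fun x ↦ k x • (U x : H →L[ℂ] H) v) μ :=
  (k.continuous.smul (hU v)).integrable_of_hasCompactSupport (HasCompactSupport.of_compactSpace _)

variable (hU : ∀ v, Continuous fun x ↦ (U x : H →L[ℂ] H) v)

variable (U) in
/-- The operator `∫ U(x) k(x) dμ(x)` attached to a strongly continuous family `U` of unitary
operators and a continuous weight `k`. -/
noncomputable def averagedOperator : C(G, ℂ) →L[ℂ] H →L[ℂ] H :=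
  LinearMap.mkContinuous₂
    (LinearMap.mk₂ ℂ (fun k v ↦ ∫ x, k x • (U x : H →L[ℂ] H) v ∂μ)
      (fun k l v ↦ by
        simp only [ContinuousMap.add_apply, add_smul,
          integral_add (integrable_smul_unitary_apply μ hU k v)
          (integrable_smul_unitary_apply μ hU l v)])
      (fun c k v ↦ by
        simp only [ContinuousMap.smul_apply, smul_assoc, integral_smul])
      (fun k v w ↦ by
        simp only [map_add, smul_add, integral_add (integrable_smul_unitary_apply μ hU k v)
          (integrable_smul_unitary_apply μ hU k w)])
      (fun c k v ↦ by
        simp only [map_smul, smul_comm _ c, integral_smul]))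
    (μ.real Set.univ)
    (fun k v ↦ by
      refine (norm_integral_le_of_norm_le_const (C := ‖k‖ * ‖v‖) (.of_forall fun x ↦ ?_)).trans
        (by rw [mul_comm, mul_assoc])
      rw [norm_smul, Unitary.norm_map]
      gcongr
      exact k.norm_coe_le_norm x)

theorem averagedOperator_apply (k : C(G, ℂ)) (v : H) :
    averagedOperator μ U hU k v = ∫ x, k x • (U x : H →L[ℂ] H) v ∂μ :=
  rfl

theorem commute_averagedOperator {S : H →L[ℂ] H} (hS : ∀ x, Commute S (U x)) (k : C(G, ℂ)) :
    Commute S (averagedOperator μ U hU k) := by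
  ext v
  simp only [mul_apply_eq_comp, averagedOperator_apply]
  rw [← S.integral_comp_comm (integrable_smul_unitary_apply μ hU k v)]
  refine integral_congr_ae (.of_forall fun x ↦ ?_)
  simpa using congr_arg (k x • ·) (DFunLike.congr_fun (hS x) v)

theorem exists_averagedOperator_apply_ne_zero [μ.IsOpenPosMeasure] {x₀ : G} (hx₀ : U x₀ = 1)
    {v : H} (hv : v ≠ 0) : ∃ k, averagedOperator μ U hU k v ≠ 0 := by
  by_contra! h
  let m : C(G, ℂ) := ⟨fun x ↦ inner ℂ v ((U x : H →L[ℂ] H) v), continuous_const.inner (hU v)⟩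
  have h0 : ∫ x, ‖m x‖ ^ 2 ∂μ = 0 := by
    have := congr_arg (inner ℂ v) (h (star m))
    rw [averagedOperator_apply, inner_zero_right, ← integral_inner
      (integrable_smul_unitary_apply μ hU _ v)] at this
    rw [← Complex.ofReal_eq_zero, ← integral_complex_ofReal, ← this]
    refine integral_congr_ae (.of_forall fun x ↦ ?_)
    simp only [inner_smul_right]
    exact (Complex.ofReal_pow _ _).trans (Complex.conj_mul' (m x)).symm
  refine (Continuous.integral_pos_of_hasCompactSupport_nonneg_nonzero (x := x₀) (μ := μ)
    (f := fun x ↦ ‖m x‖ ^ 2) (by fun_prop) (HasCompactSupport.of_compactSpace _)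
    (fun x ↦ by positivity) ?_).ne' h0
  simpa [m, hx₀] using hv

end

/-- If a compact abelian group has a strongly continuous unitary representation in which `g` acts
nontrivially, then some continuous character is nontrivial at `g`. -/
theorem exists_character_ne_one_of_unitary [CommGroup G] [IsTopologicalGroup G]
    [InnerProductSpace ℂ H] [CompleteSpace H] (U : G →* unitary (H →L[ℂ] H))
    (hU : ∀ v, Continuous fun x ↦ (U x : H →L[ℂ] H) v) {g : G} (hg : U g ≠ 1) :
    ∃ χ : G →ₜ* Circle, χ g ≠ 1 := by
  let : MeasurableSpace G := borel G
  have : BorelSpace G := ⟨rfl⟩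
  let μ : Measure G := Measure.haar
  let T := averagedOperator μ U hU
  let S : Set (H →L[ℂ] H) := Set.range fun x ↦ (U x : H →L[ℂ] H)
  let C := StarSubalgebra.centralizer ℂ S
  let A := StarSubalgebra.centralizer ℂ (C : Set (H →L[ℂ] H))
  have hcomm (x y : G) : Commute (U x : H →L[ℂ] H) (U y) := by
    rw [Commute, SemiconjBy, ← Submonoid.coe_mul, ← Submonoid.coe_mul, ← map_mul, ← map_mul,
      mul_comm]
  have hstar (x : G) : star (U x : H →L[ℂ] H) = U x⁻¹ := by
    rw [map_inv, ← Unitary.star_eq_inv, Unitary.coe_star]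
  have hmemC (a : H →L[ℂ] H) : a ∈ C ↔ ∀ x, Commute a (U x) := by
    simp only [C, S, StarSubalgebra.mem_centralizer_iff, Set.forall_mem_range, hstar]
    exact ⟨fun h x ↦ (h x).1.symm, fun h x ↦ ⟨(h x).symm, (h _).symm⟩⟩
  have hmemA (a : H →L[ℂ] H) : a ∈ A ↔ ∀ c ∈ C, Commute c a := by
    simp only [A, StarSubalgebra.mem_centralizer_iff]
    exact ⟨fun h c hc ↦ (h c hc).1, fun h c hc ↦ ⟨h c hc, h _ (star_mem hc)⟩⟩
  have hUC (x : G) : (U x : H →L[ℂ] H) ∈ C := (hmemC _).2 fun y ↦ hcomm x y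
  have hUA (x : G) : (U x : H →L[ℂ] H) ∈ A := (hmemA _).2 fun c hc ↦ (hmemC c).1 hc x
  have hTA (k : C(G, ℂ)) : T k ∈ A :=
    (hmemA _).2 fun c hc ↦ commute_averagedOperator μ hU ((hmemC c).1 hc) k
  have hAC : A ≤ C := fun a ha ↦ (hmemC a).2 fun x ↦ ((hmemA a).1 ha _ (hUC x)).symm
  have hclosed : IsClosed (A : Set (H →L[ℂ] H)) := Set.isClosed_centralizer _
  let : CStarAlgebra A := StarSubalgebra.cstarAlgebra A
  let : CommCStarAlgebra A :=
    { mul_comm := fun a b ↦ Subtype.ext ((hmemA b).1 b.2 a (hAC a.2)) }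
  let u (x : G) : A := ⟨U x, hUA x⟩
  let t (k : C(G, ℂ)) : A := ⟨T k, hTA k⟩
  have ht : Continuous t := T.continuous.subtype_mk _
  have htrans (x : G) (k : C(G, ℂ)) :
      u x * t k = t (k.comp ⟨fun y ↦ x⁻¹ * y, by fun_prop⟩) := by
    refine Subtype.ext (ContinuousLinearMap.ext fun v ↦ ?_)
    simp only [u, t, T, MulMemClass.mk_mul_mk, mul_apply_eq_comp,
      averagedOperator_apply]
    rw [← (U x : H →L[ℂ] H).integral_comp_comm (integrable_smul_unitary_apply μ hU k v)]
    refine Eq.trans ?_ (integral_mul_left_eq_self _ x)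
    simp
  obtain ⟨k, hk⟩ : ∃ k, (u g - 1) * t k ≠ 0 := by
    by_contra! h
    obtain ⟨v, hv⟩ : ∃ v, (U g : H →L[ℂ] H) v - v ≠ 0 := by
      by_contra! hv
      exact hg (Subtype.ext (ContinuousLinearMap.ext fun v ↦ sub_eq_zero.1 (hv v)))
    obtain ⟨k, hk⟩ := exists_averagedOperator_apply_ne_zero μ hU (map_one U) hv
    refine hk ?_
    have h1 := h k
    rw [mul_comm] at h1
    exact DFunLike.congr_fun (congr_arg Subtype.val h1) v
  obtain ⟨φ, hφ⟩ : ∃ φ : WeakDual.characterSpace ℂ A, φ ((u g - 1) * t k) ≠ 0 := by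
    by_contra! h
    exact hk ((gelfandTransform_isometry A).injective (by
      rw [map_zero]
      exact ContinuousMap.ext h))
  rw [map_mul, map_sub, map_one, mul_ne_zero_iff, sub_ne_zero] at hφ
  have hcont : Continuous fun x ↦ φ (u x) := by
    have h1 : Continuous fun x ↦ φ (u x * t k) := by
      simp only [htrans]
      refine (map_continuous φ).comp (ht.comp ?_)
      exact (ContinuousMap.curry ⟨fun z : G × G ↦ k (z.1⁻¹ * z.2), by fun_prop⟩).continuous
    simpa [hφ.2] using h1.div_const (φ (t k))
  have humul (x y : G) : u (x * y) = u x * u y := Subtype.ext (by simp [u])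
  have hnorm (x : G) : φ (u x) ∈ Submonoid.unitSphere ℂ := by
    have : star (u x) * u x = 1 := Subtype.ext (Unitary.coe_star_mul_self (U x))
    have := congr_arg φ this
    rw [map_mul, map_star, map_one, RCLike.star_def, Complex.conj_mul'] at this
    have h2 : ‖φ (u x)‖ ^ 2 = 1 := by exact_mod_cast this
    exact mem_sphere_zero_iff_norm.2 ((pow_eq_one_iff_of_nonneg (norm_nonneg _) two_ne_zero).1 h2)
  refine ⟨⟨MonoidHom.mk' (fun x ↦ (⟨φ (u x), hnorm x⟩ : Circle)) fun x y ↦ ?_, ?_⟩, fun h ↦ ?_⟩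
  · exact Circle.ext (show φ (u (x * y)) = φ (u x) * φ (u y) by rw [humul, map_mul])
  · exact hcont.subtype_mk _
  · exact hφ.1 (congr_arg Subtype.val h)

/-- The continuous characters of a compact Hausdorff abelian group separate points. -/
theorem exists_character_ne_one [CommGroup G] [IsTopologicalGroup G] [T2Space G] {g : G}
    (hg : g ≠ 1) : ∃ χ : G →ₜ* Circle, χ g ≠ 1 := by
  let : MeasurableSpace G := borel G
  have : BorelSpace G := ⟨rfl⟩
  let μ : Measure G := Measure.haar
  let L (x : G) : Lp ℂ 2 μ →ₗᵢ[ℂ] Lp ℂ 2 μ :=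
    { toFun := fun f ↦ DomMulAct.mk x • f
      map_add' := smul_add _
      map_smul' := fun c f ↦ smul_comm _ c f
      norm_map' := DomMulAct.norm_smul_Lp _ }
  let U : G →* unitary (Lp ℂ 2 μ →L[ℂ] Lp ℂ 2 μ) := MonoidHom.mk' (fun x ↦
    Unitary.linearIsometryEquiv.symm <| LinearIsometryEquiv.ofSurjective (L x) fun f ↦
      ⟨DomMulAct.mk x⁻¹ • f, by simp [L, smul_smul]⟩) fun x y ↦
        Subtype.ext <| ContinuousLinearMap.ext fun f ↦ by
          rw [mul_comm x]
          exact mul_smul (DomMulAct.mk x) (DomMulAct.mk y) f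
  have : Fact ((2 : ENNReal) ≠ ⊤) := ⟨by simp⟩
  refine exists_character_ne_one_of_unitary U (fun f ↦ ?_) (g := g) fun h ↦ ?_
  · exact (DomMulAct.continuous_mk.smul continuous_const :
      Continuous fun x : G ↦ DomMulAct.mk x • f)
  obtain ⟨f, hf, hf1, -⟩ := exists_continuous_zero_one_of_isClosed (isClosed_singleton (x := g))
    (isClosed_singleton (x := (1 : G))) (by simpa using hg)
  let F : C(G, ℂ) := ⟨fun x ↦ f x, by fun_prop⟩
  have h1 : DomMulAct.mk g • F.toLp 2 μ ℂ = F.toLp 2 μ ℂ :=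
    DFunLike.congr_fun (congr_arg Subtype.val h) (F.toLp 2 μ ℂ)
  have h2 : F.comp ⟨fun x ↦ g * x, by fun_prop⟩ = F := ContinuousMap.toLp_injective μ h1
  have h3 := DFunLike.congr_fun h2 1
  have h4 : f g = 0 := hf rfl
  have h5 : f 1 = 1 := hf1 rfl
  simp [F, h4, h5] at h3

end Characters

/-- Every compact Hausdorff abelian topological group which, as a topological space,
is simply connected and an AE(1)-compactum consists of a single element. -/
theorem simplyConnected_AE1_compact_abelian_group_subsingleton
    (G : Type u) [CommGroup G] [TopologicalSpace G] [IsTopologicalGroup G]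
    [CompactSpace G] [T2Space G]
    (hsc : SimplyConnectedSpace G) (hae : IsAE 1 G) :
    ∃ g : G, ∀ x : G, x = g := by
  have := hsc
  refine ⟨1, fun x ↦ ?_⟩
  by_contra hx
  obtain ⟨χ, hχ⟩ := exists_character_ne_one hx
  exact hχ (by rw [continuousMonoidHom_circle_eq_one_of_isAE_one hae χ]; rfl)
end

section
/- A compact Hausdorff abelian topological group G is an AE(1)-compactum if and only if G is a torus, i.e. G is isomorphic as a topological group to a product ∏_{t∈T} 𝕋 of copies of the circle group over some (possibly infinite or empty) index set T. -/
open Topology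

universe u

theorem linearIndependent_of_triangular {R ι : Type*} [CommRing R] [IsDomain R]
    [LinearOrder ι] {p : ι → Prop} (v : {i // p i} → ι →₀ R) (hv : ∀ j, v j j ≠ 0)
    (hv' : ∀ j k : {i // p i}, j < k → v j k = 0) : LinearIndependent R v := by
  rw [linearIndependent_iff]
  intro l hl
  by_contra hne
  have hs : l.support.Nonempty := Finsupp.support_nonempty_iff.2 hne
  have hmax := Finset.max'_mem _ hs
  set m := l.support.max' hs with hm
  have h1 : Finsupp.linearCombination R v l m = l m * v m m := by
    rw [Finsupp.linearCombination_apply, Finsupp.sum, Finsupp.finsetSum_apply,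
      Finset.sum_eq_single m]
    · rfl
    · intro b hb hbm
      have h0 : v b m = 0 := hv' _ _ (lt_of_le_of_ne (Finset.le_max' _ _ hb) hbm)
      rw [Finsupp.smul_apply, h0, smul_zero]
    · intro h
      exact absurd hmax h
  rw [hl, Finsupp.zero_apply] at h1
  exact (mul_eq_zero.1 h1.symm).elim (Finsupp.mem_support_iff.1 hmax) (hv m)

theorem Submodule.free_of_finsupp_of_pid {R ι : Type*} [CommRing R] [IsDomain R]
    [IsPrincipalIdealRing R] (N : Submodule R (ι →₀ R)) : Module.Free R N := by
  obtain ⟨_, _⟩ := exists_wellFoundedLT ι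
  let N' (i : ι) : Submodule R (ι →₀ R) := N ⊓ Finsupp.supported R R (Set.Iic i)
  let L (i : ι) : Ideal R := (N' i).map (Finsupp.lapply i)
  have hL (i : ι) : ∃ n ∈ N' i, n i = Submodule.IsPrincipal.generator (L i) :=
    Submodule.mem_map.1 (Submodule.IsPrincipal.generator_mem (L i))
  choose n hn hn' using hL
  have hzero {i j : ι} (hij : i < j) : n i j = 0 := by
    by_contra h
    have := (Finsupp.mem_supported R (n i)).1 (hn i).2 (Finsupp.mem_support_iff.2 h)
    exact absurd hij (not_lt.2 this)
  let J := {i : ι // n i i ≠ 0}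
  let v (j : J) : N := ⟨n j, (hn j).1⟩
  have hli : LinearIndependent R v := by
    refine LinearIndependent.of_comp N.subtype ?_
    exact linearIndependent_of_triangular _ (fun j ↦ j.2) fun _ _ h ↦ hzero h
  have key (i : ι) : ∀ x : N, (x : ι →₀ R) ∈ N' i → x ∈ Submodule.span R (Set.range v) := by
    induction i using WellFoundedLT.induction with
    | ind i ih =>
      intro x hx
      obtain ⟨c, hc⟩ := (Submodule.IsPrincipal.mem_iff_eq_smul_generator (L i)).1
        (Submodule.mem_map_of_mem (f := Finsupp.lapply i) hx)
      rw [← hn' i] at hc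
      have hci : (x : ι →₀ R) i = c * n i i := hc
      have hsub : ∀ y : N, (y : ι →₀ R) ∈ N' i → (y : ι →₀ R) i = 0 →
          y ∈ Submodule.span R (Set.range v) := by
        intro y hy hyi
        by_cases hs : (y : ι →₀ R).support.Nonempty
        · have hmem := Finset.max'_mem _ hs
          have hle := (Finsupp.mem_supported R _).1 hy.2 hmem
          refine ih _ (lt_of_le_of_ne hle ?_) y ⟨y.2, ?_⟩
          · intro h
            rw [h] at hmem
            exact Finsupp.mem_support_iff.1 hmem hyi
          · exact (Finsupp.mem_supported R _).2 fun z hz ↦ Finset.le_max' _ _ hz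
        · rw [Finset.not_nonempty_iff_eq_empty, Finsupp.support_eq_empty] at hs
          have : y = 0 := Subtype.ext hs
          rw [this]
          exact zero_mem _
      by_cases hi : n i i = 0
      · exact hsub x hx (by rw [hci, hi, mul_zero])
      · have hv : v ⟨i, hi⟩ ∈ Submodule.span R (Set.range v) :=
          Submodule.subset_span ⟨_, rfl⟩
        have := hsub (x - c • v ⟨i, hi⟩)
          (Submodule.sub_mem _ hx (Submodule.smul_mem _ _ (hn i))) (by
            change (x : ι →₀ R) i - c * n i i = 0
            rw [hci, sub_self])
        rw [← sub_add_cancel x (c • v ⟨i, hi⟩)]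
        exact Submodule.add_mem _ this (Submodule.smul_mem _ _ hv)
  refine Module.Free.of_basis (Module.Basis.mk hli ?_)
  intro x _
  by_cases hs : (x : ι →₀ R).support.Nonempty
  · exact key ((x : ι →₀ R).support.max' hs) x
      ⟨x.2, (Finsupp.mem_supported R _).2 fun z hz ↦ Finset.le_max' _ _ hz⟩
  · rw [Finset.not_nonempty_iff_eq_empty, Finsupp.support_eq_empty] at hs
    have : x = 0 := Subtype.ext hs
    rw [this]
    exact zero_mem _

theorem Module.Free.of_injective_of_pid {R M P : Type*} [CommRing R] [IsDomain R]
    [IsPrincipalIdealRing R] [AddCommGroup M] [Module R M] [AddCommGroup P] [Module R P]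
    [Module.Free R P] (f : M →ₗ[R] P) (hf : Function.Injective f) : Module.Free R M := by
  let g := (Module.Free.chooseBasis R P).repr.toLinearMap ∘ₗ f
  have hg : Function.Injective g :=
    (Module.Free.chooseBasis R P).repr.injective.comp hf
  have := Submodule.free_of_finsupp_of_pid (LinearMap.range g)
  exact Module.Free.of_equiv (LinearEquiv.ofInjective g hg).symm

open unitInterval in
theorem covDimLE_one_unitInterval_prod (D : Type u) [TopologicalSpace D] [CompactSpace D]
    [T2Space D] [TotallyDisconnectedSpace D] : CovDimLE (I × D) 1 := by
  classical
  intro 𝒰 hopen hcov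
  let _ : UniformSpace D := uniformSpaceOfCompactR1
  obtain ⟨E, hE, hEU⟩ := lebesgue_number_lemma (K := (Set.univ : Set (I × D)))
    (U := fun U : {U // U ∈ 𝒰} ↦ (U : Set (I × D))) isCompact_univ (fun U ↦ hopen U U.2)
    (by rw [← hcov, Set.sUnion_eq_iUnion]; rfl)
  obtain ⟨A, hA, B, hB, hAB⟩ := entourageProd_subset hE
  obtain ⟨ε, hε, hεA⟩ := Metric.mem_uniformity_dist.1 hA
  obtain ⟨n, W, hW, hWcov, hWd⟩ := TopologicalSpace.IsOpenCover.exists_finite_nonempty_disjoint_clopen_cover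
    (U := fun d : D ↦ (⟨interior (UniformSpace.ball d B), isOpen_interior⟩ : TopologicalSpace.Opens D)) (by
      rw [TopologicalSpace.IsOpenCover.eq_1, eq_top_iff]
      intro d _
      rw [TopologicalSpace.Opens.mem_iSup]
      exact ⟨d, mem_interior_iff_mem_nhds.2 (UniformSpace.ball_mem_nhds d hB)⟩)
  choose d hd using fun j ↦ (hW j).2
  obtain ⟨N, hN⟩ := exists_nat_one_div_lt hε
  have hN0 : (0 : ℝ) < N + 1 := by positivity
  let c (k : ℤ) : Set I := {t | |(t : ℝ) * (N + 1) - k| < 1}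
  have hc (k : ℤ) : IsOpen (c k) := isOpen_lt (by fun_prop) continuous_const
  let S := (Finset.Icc (0 : ℤ) (N + 1) ×ˢ (Finset.univ : Finset (Fin n)))
  let V (q : ℤ × Fin n) : Set (I × D) := c q.1 ×ˢ (W q.2 : Set D)
  have hfloor (t : I) : ⌊(t : ℝ) * (N + 1)⌋ ∈ Finset.Icc (0 : ℤ) (N + 1) := by
    rw [Finset.mem_Icc]
    constructor
    · exact Int.floor_nonneg.2 (mul_nonneg t.2.1 hN0.le)
    · rw [Int.floor_le_iff]
      have := t.2.2
      push_cast
      nlinarith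
  refine ⟨S.image V, ?_, ?_, ?_, ?_⟩
  · intro U hU
    obtain ⟨q, -, rfl⟩ := Finset.mem_image.1 hU
    exact (hc _).prod (W q.2).isClopen.isOpen
  · refine Set.eq_univ_of_forall fun ⟨t, x⟩ ↦ ?_
    obtain ⟨j, hj⟩ := Set.mem_iUnion.1 (hWcov (Set.mem_univ x))
    refine ⟨V (⌊(t : ℝ) * (N + 1)⌋, j), Finset.mem_coe.2 (Finset.mem_image_of_mem _
      (Finset.mem_product.2 ⟨hfloor t, Finset.mem_univ _⟩)), ?_, hj⟩
    have h1 := Int.floor_le ((t : ℝ) * (N + 1))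
    have h2 := Int.lt_floor_add_one ((t : ℝ) * (N + 1))
    change |_| < (1 : ℝ)
    rw [abs_lt]
    constructor <;> linarith
  · intro U hU
    obtain ⟨⟨k, j⟩, hq, rfl⟩ := Finset.mem_image.1 hU
    have hk := Finset.mem_Icc.1 (Finset.mem_product.1 hq).1
    have hk0 : (0 : ℝ) ≤ k := by exact_mod_cast hk.1
    have hk1 : (k : ℝ) ≤ N + 1 := by exact_mod_cast hk.2
    let t₀ : I := ⟨k / (N + 1), by positivity, by rwa [div_le_one hN0]⟩
    obtain ⟨U, hU⟩ := hEU (t₀, d j) (Set.mem_univ _)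
    refine ⟨U, U.2, fun ⟨t, x⟩ ⟨ht, hx⟩ ↦ hU (hAB ⟨?_, ?_⟩)⟩
    swap
    · exact (interior_subset (hd j hx) : x ∈ UniformSpace.ball (d j) B)
    refine hεA ?_
    rw [Subtype.dist_eq, Real.dist_eq, abs_sub_comm]
    refine lt_of_le_of_lt ?_ hN
    have ht' : |(t : ℝ) * (N + 1) - k| < 1 := ht
    have h : ((t : ℝ) - t₀) * (N + 1) = t * (N + 1) - k := by
      rw [sub_mul, div_mul_cancel₀ _ hN0.ne']
    rw [← h, abs_mul, abs_of_pos hN0] at ht'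
    rw [le_div_iff₀ hN0]
    exact ht'.le
  · rintro ⟨t, x⟩
    obtain ⟨j, hj⟩ := Set.mem_iUnion.1 (hWcov (Set.mem_univ x))
    set k := ⌊(t : ℝ) * (N + 1)⌋ with hk
    have hsub : {U : Set (I × D) | U ∈ S.image V ∧ (t, x) ∈ U} ⊆ {V (k, j), V (k + 1, j)} := by
      rintro U ⟨hU, hx⟩
      obtain ⟨⟨l, i⟩, -, rfl⟩ := Finset.mem_image.1 hU
      have hij : i = j := by
        by_contra h
        have := hWd h
        exact Set.disjoint_left.1 (TopologicalSpace.Clopens.coe_disjoint.2 this) hx.2 hj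
      have hl : |(t : ℝ) * (N + 1) - l| < 1 := hx.1
      rw [abs_lt] at hl
      have h1 := Int.floor_le ((t : ℝ) * (N + 1))
      have h2 := Int.lt_floor_add_one ((t : ℝ) * (N + 1))
      rw [← hk] at h1 h2
      have h3 : (l : ℝ) < k + 2 := by linarith
      have h4 : (k : ℝ) - 1 < l := by linarith
      have h5 : l < k + 2 := by exact_mod_cast h3
      have h6 : k - 1 < l := by exact_mod_cast h4
      have : l = k ∨ l = k + 1 := by omega
      rcases this with rfl | rfl
      · exact Or.inl (by rw [hij])
      · exact Or.inr (by rw [hij]; rfl)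
    calc Nat.card {U : Set (I × D) // U ∈ S.image V ∧ (t, x) ∈ U}
        = {U : Set (I × D) | U ∈ S.image V ∧ (t, x) ∈ U}.ncard := rfl
      _ ≤ ({V (k, j), V (k + 1, j)} : Set (Set (I × D))).ncard :=
          Set.ncard_le_ncard hsub (Set.toFinite _)
      _ ≤ 1 + 1 := Set.ncard_insert_le _ _ |>.trans (by rw [Set.ncard_singleton])

theorem Circle.exists_coe_ne_neg {ι : Type*} [Finite ι] (c : ι → Circle) :
    ∃ p : Circle, ∀ i, (p : ℂ) ≠ -c i := by
  have hinf : (Circle.exp '' Set.Ioc (-Real.pi) Real.pi).Infinite :=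
    (Set.Ioc_infinite (by linarith [Real.pi_pos])).image
      (fun x hx y hy h ↦ by
        have : Complex.arg (Circle.exp x) = Complex.arg (Circle.exp y) := by rw [h]
        rwa [Circle.arg_exp hx.1 hx.2, Circle.arg_exp hy.1 hy.2] at this)
  have hfin : {p : Circle | ∃ i, (p : ℂ) = -c i}.Finite := by
    refine Set.Finite.of_finite_image (f := fun p : Circle ↦ (p : ℂ)) ?_
      Circle.coe_injective.injOn
    refine (Set.finite_range fun i ↦ -(c i : ℂ)).subset ?_
    rintro _ ⟨p, ⟨i, hi⟩, rfl⟩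
    exact ⟨i, hi.symm⟩
  obtain ⟨p, -, hp⟩ := hinf.exists_notMem_finite hfin
  exact ⟨p, fun i hi ↦ hp ⟨i, hi⟩⟩

theorem exists_nonvanishing_approx_of_covDimLE_one {Z : Type u} [TopologicalSpace Z]
    [CompactSpace Z] [T2Space Z] (hZ : CovDimLE Z 1) (Z₀ : Set Z) (F : C(Z, ℂ))
    (hF : ∀ z ∈ Z₀, ‖F z‖ = 1) :
    ∃ f : C(Z, ℂ), (∀ z, f z ≠ 0) ∧ ∀ z ∈ Z₀, ‖f z - F z‖ ≤ 1 / 2 := by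
  classical
  let B (z : Z) : Set Z := F ⁻¹' Metric.ball (F z) (1 / 4)
  have hB (z : Z) : IsOpen (B z) := Metric.isOpen_ball.preimage F.continuous
  obtain ⟨t, ht⟩ := isCompact_univ.elim_finite_subcover B hB
    fun z _ ↦ Set.mem_iUnion.2 ⟨z, Metric.mem_ball_self (by norm_num)⟩
  obtain ⟨𝒱, hVo, hVc, hVr, hVn⟩ := hZ (t.image B)
    (fun U hU ↦ by obtain ⟨z, -, rfl⟩ := Finset.mem_image.1 hU; exact hB z)
    (Set.eq_univ_of_forall fun z ↦ by
      obtain ⟨y, hy, hzy⟩ := Set.mem_iUnion₂.1 (ht (Set.mem_univ z))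
      exact ⟨B y, Finset.mem_coe.2 (Finset.mem_image_of_mem B hy), hzy⟩)
  have hosc : ∀ V ∈ 𝒱, ∀ x ∈ V, ∀ y ∈ V, ‖F x - F y‖ < 1 / 2 := by
    intro V hV x hx y hy
    obtain ⟨U, hU, hVU⟩ := hVr V hV
    obtain ⟨w, -, rfl⟩ := Finset.mem_image.1 hU
    have h1 : dist (F x) (F w) < 1 / 4 := hVU hx
    have h2 : dist (F y) (F w) < 1 / 4 := hVU hy
    rw [← dist_eq_norm]
    have := dist_triangle_right (F x) (F y) (F w)
    linarith
  obtain ⟨p, hp⟩ := PartitionOfUnity.exists_isSubordinate (isClosed_univ (X := Z))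
    (fun V : {V // V ∈ 𝒱} ↦ (V : Set Z)) (fun V ↦ hVo V V.2) (by
      rw [← hVc, Set.sUnion_eq_iUnion]; rfl)
  have hpV (V : {V // V ∈ 𝒱}) (z : Z) (h : p V z ≠ 0) : z ∈ (V : Set Z) :=
    hp V (subset_tsupport _ h)
  have hsum (z : Z) : ∑ V, p V z = 1 := by
    rw [← finsum_eq_sum_of_fintype]
    exact p.sum_eq_one (Set.mem_univ z)
  have hc₀ : ∀ V : {V // V ∈ 𝒱}, ∃ c : Circle, ∀ a ∈ Z₀, a ∈ (V : Set Z) →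
      ∃ b ∈ (V : Set Z), (c : ℂ) = F b := by
    intro V
    by_cases h : ∃ a ∈ Z₀, a ∈ (V : Set Z)
    · obtain ⟨a, ha, haV⟩ := h
      exact ⟨⟨F a, mem_sphere_zero_iff_norm.2 (hF a ha)⟩, fun _ _ _ ↦ ⟨a, haV, rfl⟩⟩
    · exact ⟨1, fun a ha haV ↦ (h ⟨a, ha, haV⟩).elim⟩
  choose c₀ hc₀ using hc₀
  obtain ⟨q, hq⟩ := Circle.exists_coe_ne_neg c₀
  let c (V : {V // V ∈ 𝒱}) : Circle := if ∃ a ∈ Z₀, a ∈ (V : Set Z) then c₀ V else q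
  have hc (V W : {V // V ∈ 𝒱}) (z : Z) (hV : z ∈ (V : Set Z)) (hW : z ∈ (W : Set Z)) :
      (c V : ℂ) + c W ≠ 0 := by
    intro h
    by_cases h1 : ∃ a ∈ Z₀, a ∈ (V : Set Z) <;> by_cases h2 : ∃ a ∈ Z₀, a ∈ (W : Set Z)
    · simp only [c, if_pos h1, if_pos h2] at h
      obtain ⟨a, ha, haV⟩ := h1
      obtain ⟨x, hx, hVx⟩ := hc₀ V a ha haV
      obtain ⟨b, hb, hbW⟩ := h2
      obtain ⟨y, hy, hWy⟩ := hc₀ W b hb hbW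
      have h3 := hosc V V.2 x hx z hV
      have h4 := hosc W W.2 z hW y hy
      have h5 : ‖(c₀ V : ℂ) - c₀ W‖ < 1 := by
        rw [hVx, hWy]
        calc ‖F x - F y‖ ≤ ‖F x - F z‖ + ‖F z - F y‖ := norm_sub_le_norm_sub_add_norm_sub _ _ _
          _ < 1 := by linarith
      rw [eq_neg_of_add_eq_zero_right h, sub_neg_eq_add, ← two_mul, norm_mul,
        Circle.norm_coe] at h5
      norm_num at h5
    · simp only [c, if_pos h1, if_neg h2] at h
      exact hq V (eq_neg_of_add_eq_zero_right h)
    · simp only [c, if_neg h1, if_pos h2] at h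
      exact hq W (eq_neg_of_add_eq_zero_left h)
    · simp only [c, if_neg h1, if_neg h2, ← two_mul] at h
      exact Circle.coe_ne_zero q ((mul_eq_zero.1 h).resolve_left two_ne_zero)
  refine ⟨⟨fun z ↦ ∑ V, (p V z : ℂ) * c V, by fun_prop⟩, fun z h0 ↦ ?_, fun z hz ↦ ?_⟩
  · change ∑ V, (p V z : ℂ) * c V = 0 at h0
    obtain ⟨V, -, hV⟩ : ∃ V ∈ Finset.univ, p V z ≠ 0 :=
      Finset.exists_ne_zero_of_sum_ne_zero (by rw [hsum z]; exact one_ne_zero)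
    by_cases hW : ∃ W, W ≠ V ∧ p W z ≠ 0
    · obtain ⟨W, hWV, hW⟩ := hW
      have hother : ∀ X, X ≠ V ∧ X ≠ W → (p X z : ℂ) * c X = 0 := by
        rintro X ⟨hXV, hXW⟩
        by_contra hX
        have hX' : p X z ≠ 0 := fun h ↦ hX (by rw [h, Complex.ofReal_zero, zero_mul])
        have hthree : ({(V : Set Z), (W : Set Z), (X : Set Z)} : Set (Set Z)) ⊆
            {U : Set Z | U ∈ 𝒱 ∧ z ∈ U} := by
          rintro U (rfl | rfl | rfl)
          · exact ⟨V.2, hpV V z hV⟩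
          · exact ⟨W.2, hpV W z hW⟩
          · exact ⟨X.2, hpV X z hX'⟩
        have hfin : {U : Set Z | U ∈ 𝒱 ∧ z ∈ U}.Finite :=
          𝒱.finite_toSet.subset fun U hU ↦ hU.1
        have h2 : {U : Set Z | U ∈ 𝒱 ∧ z ∈ U}.ncard ≤ 2 := hVn z
        have h3 := Set.ncard_le_ncard hthree hfin
        rw [Set.ncard_eq_three.2 ⟨_, _, _, fun h ↦ hWV (Subtype.ext h.symm),
          fun h ↦ hXV (Subtype.ext h.symm), fun h ↦ hXW (Subtype.ext h.symm), rfl⟩] at h3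
        omega
      rw [Fintype.sum_eq_add V W hWV.symm hother] at h0
      have h1 : (p V z : ℂ) * c V = -(p W z * c W) := eq_neg_of_add_eq_zero_left h0
      have h2 := congrArg norm h1
      rw [norm_neg, norm_mul, norm_mul, Circle.norm_coe, Circle.norm_coe, mul_one, mul_one,
        Complex.norm_real, Complex.norm_real, Real.norm_of_nonneg (p.nonneg V z),
        Real.norm_of_nonneg (p.nonneg W z)] at h2
      rw [h2, ← mul_add] at h0
      exact hc V W z (hpV V z hV) (hpV W z hW)
        ((mul_eq_zero.1 h0).resolve_left (Complex.ofReal_ne_zero.2 hW))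
    · push Not at hW
      rw [Fintype.sum_eq_single V fun W hWV ↦ by
        rw [hW W hWV, Complex.ofReal_zero, zero_mul]] at h0
      exact (mul_ne_zero (Complex.ofReal_ne_zero.2 hV) (Circle.coe_ne_zero _)) h0
  · have h1 : ∑ V, (p V z : ℂ) * c V - F z = ∑ V, (p V z : ℂ) * (c V - F z) := by
      simp_rw [mul_sub, Finset.sum_sub_distrib, ← Finset.sum_mul, ← Complex.ofReal_sum, hsum z]
      rw [Complex.ofReal_one, one_mul]
    change ‖∑ V, (p V z : ℂ) * c V - F z‖ ≤ 1 / 2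
    rw [h1]
    calc ‖∑ V, (p V z : ℂ) * (c V - F z)‖ ≤ ∑ V, ‖(p V z : ℂ) * (c V - F z)‖ := norm_sum_le _ _
      _ ≤ ∑ V, p V z * (1 / 2) := by
          refine Finset.sum_le_sum fun V _ ↦ ?_
          rw [norm_mul, Complex.norm_real, Real.norm_of_nonneg (p.nonneg V z)]
          by_cases hV : p V z = 0
          · rw [hV, zero_mul, zero_mul]
          · refine mul_le_mul_of_nonneg_left ?_ (p.nonneg V z)
            have hzV := hpV V z hV
            simp only [c, if_pos (⟨z, hz, hzV⟩ : ∃ a ∈ Z₀, a ∈ (V : Set Z))]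
            obtain ⟨b, hb, hVb⟩ := hc₀ V z hz hzV
            rw [hVb]
            exact (hosc V V.2 b hb z hzV).le
      _ = 1 / 2 := by rw [← Finset.sum_mul, hsum z, one_mul]

theorem Circle.exists_extension_of_covDimLE_one {Z : Type u} [TopologicalSpace Z]
    [CompactSpace Z] [T2Space Z] (hZ : CovDimLE Z 1) {Z₀ : Set Z} (hZ₀ : IsClosed Z₀)
    (g₀ : C(Z₀, Circle)) : ∃ g : C(Z, Circle), ∀ z : Z₀, g z = g₀ z := by
  obtain ⟨F, hF⟩ := ContinuousMap.exists_restrict_eq hZ₀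
    (⟨fun z ↦ (g₀ z : ℂ), by fun_prop⟩ : C(Z₀, ℂ))
  have hF' (z : Z₀) : F z = g₀ z := congrArg (fun f : C(Z₀, ℂ) ↦ f z) hF
  obtain ⟨f, hf0, hf⟩ := exists_nonvanishing_approx_of_covDimLE_one hZ Z₀ F
    (fun z hz ↦ by rw [hF' ⟨z, hz⟩, Circle.norm_coe])
  have hslit (z : Z₀) : f z * (g₀ z : ℂ)⁻¹ ∈ Complex.slitPlane := by
    refine Complex.mem_slitPlane_of_norm_lt_one (z := f z * (g₀ z : ℂ)⁻¹ - 1) ?_ |> fun h ↦ by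
      simpa using h
    have h1 : f z * (g₀ z : ℂ)⁻¹ - 1 = (f z - F z) * (g₀ z : ℂ)⁻¹ := by
      rw [hF' z, sub_mul, mul_inv_cancel₀ (Circle.coe_ne_zero _)]
    rw [h1, norm_mul, norm_inv, Circle.norm_coe]
    have := hf z z.2
    linarith
  obtain ⟨Θ, hΘ⟩ := ContinuousMap.exists_restrict_eq hZ₀
    (⟨fun z ↦ Complex.arg (f z * (g₀ z : ℂ)⁻¹), by
      refine continuous_iff_continuousAt.2 fun z ↦ ?_
      refine (Complex.continuousAt_arg (hslit z)).comp (f := fun z : Z₀ ↦ f z * (g₀ z : ℂ)⁻¹) ?_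
      have h1 : Continuous fun z : Z₀ ↦ (g₀ z : ℂ)⁻¹ :=
        Continuous.inv₀ (by fun_prop) fun z ↦ Circle.coe_ne_zero _
      exact ((f.continuous.comp continuous_subtype_val).mul h1).continuousAt⟩ : C(Z₀, ℝ))
  have hΘ' (z : Z₀) : Θ z = Complex.arg (f z * (g₀ z : ℂ)⁻¹) :=
    congrArg (fun f : C(Z₀, ℝ) ↦ f z) hΘ
  have hu (z : Z) : f z / ‖f z‖ ∈ Submonoid.unitSphere ℂ := by
    refine mem_sphere_zero_iff_norm.2 ?_
    rw [norm_div, Complex.norm_real, norm_norm, div_self (norm_ne_zero_iff.2 (hf0 z))]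
  let u (z : Z) : Circle := ⟨f z / ‖f z‖, hu z⟩
  refine ⟨⟨fun z ↦ u z * (Circle.exp (Θ z))⁻¹, ?_⟩, fun z ↦ ?_⟩
  · refine Continuous.mul ?_ (Circle.exp.continuous.comp Θ.continuous).inv
    refine Continuous.subtype_mk ?_ _
    refine f.continuous.div ?_ fun z ↦ Complex.ofReal_ne_zero.2 (norm_ne_zero_iff.2 (hf0 z))
    fun_prop
  · change u z * (Circle.exp (Θ z))⁻¹ = g₀ z
    rw [mul_inv_eq_iff_eq_mul]
    refine Circle.coe_injective ?_
    rw [Circle.coe_mul, Circle.coe_exp, hΘ']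
    change f z / ‖f z‖ = _
    have h1 := Complex.norm_mul_exp_arg_mul_I (f z * (g₀ z : ℂ)⁻¹)
    rw [norm_mul, norm_inv, Circle.norm_coe, inv_one, mul_one] at h1
    have h2 : (‖f z‖ : ℂ) ≠ 0 := Complex.ofReal_ne_zero.2 (norm_ne_zero_iff.2 (hf0 z))
    rw [div_eq_iff h2, mul_assoc, mul_comm (Complex.exp _), h1, mul_comm (f z),
      mul_inv_cancel_left₀ (Circle.coe_ne_zero _)]

theorem isAE_one_of_torus {G : Type u} [Group G] [TopologicalSpace G] {T : Type u}
    (e : G ≃* (T → Circle)) (he : IsTopGroupIso e) : IsAE 1 G := by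
  intro Z _ _ _ hZ Z₀ hZ₀ g₀
  have h (t : T) := Circle.exists_extension_of_covDimLE_one hZ hZ₀
    ⟨fun z ↦ e (g₀ z) t, (continuous_apply t).comp (he.1.comp g₀.continuous)⟩
  choose g hg using h
  refine ⟨⟨fun z ↦ e.symm fun t ↦ g t z,
    he.2.comp (continuous_pi fun t ↦ (g t).continuous)⟩, fun z ↦ ?_⟩
  change e.symm (fun t ↦ g t z) = g₀ z
  rw [MulEquiv.symm_apply_eq]
  exact funext fun t ↦ hg t z

theorem ContinuousMonoidHom.eq_one_of_exp_lift {G : Type*} [CommGroup G] [TopologicalSpace G]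
    [IsTopologicalGroup G] [CompactSpace G] [PreconnectedSpace G] (χ : G →ₜ* Circle) (f : C(G, ℝ))
    (hf : ∀ x, Circle.exp (f x) = χ x) : χ = 1 := by
  let k (q : G × G) : ℝ := f (q.1 * q.2) - f q.1 - f q.2
  have hk : Continuous k := by fun_prop
  have hk1 (q : G × G) : Circle.exp (k q) = 1 := by
    rw [Circle.exp_sub, Circle.exp_sub, hf, hf, hf, map_mul, mul_div_cancel_left, div_self']
  have hconst (x y : G) : f (x * y) - f x - f y = f (1 * 1) - f 1 - f 1 :=
    Circle.isCoveringMap_exp.const_of_comp hk (fun a a' ↦ by rw [hk1, hk1]) (x, y) (1, 1)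
  have hadd (x y : G) : f (x * y) - f 1 = (f x - f 1) + (f y - f 1) := by
    have := hconst x y
    rw [mul_one] at this
    linarith
  have hpow (x : G) (n : ℕ) : f (x ^ n) - f 1 = n * (f x - f 1) := by
    induction n with
    | zero => simp
    | succ n ih => rw [pow_succ, hadd, ih]; push_cast; ring
  obtain ⟨C, hC⟩ := (isCompact_range (f := fun x ↦ f x - f 1) (by fun_prop)).isBounded.exists_norm_le
  have hzero (x : G) : f x = f 1 := by
    by_contra h
    have hpos : 0 < ‖f x - f 1‖ := norm_pos_iff.2 (sub_ne_zero.2 h)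
    obtain ⟨n, hn⟩ := exists_nat_gt (C / ‖f x - f 1‖)
    rw [div_lt_iff₀ hpos] at hn
    have h1 : ‖f (x ^ n) - f 1‖ ≤ C := hC _ ⟨x ^ n, rfl⟩
    rw [hpow, norm_mul, Real.norm_natCast] at h1
    linarith
  ext x
  rw [← hf, hzero, hf, map_one]
  rfl

open unitInterval in
theorem IsAE.exists_homotopy_ultrafilter {G : Type u} [Group G] [TopologicalSpace G]
    [CompactSpace G] [T2Space G] (hG : IsAE 1 G) :
    ∃ h : C(I × Ultrafilter G, G), (∀ d, h (0, d) = 1) ∧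
      ∀ d, h (1, d) = Ultrafilter.extend id d := by
  classical
  let Z₀ : Set (I × Ultrafilter G) := {z | z.1 = 0 ∨ z.1 = 1}
  have hZ₀ : IsClosed Z₀ := (isClosed_eq continuous_fst continuous_const).union
    (isClosed_eq continuous_fst continuous_const)
  have hclopen : IsClopen {z : Z₀ | z.1.1 = 0} := by
    refine ⟨isClosed_eq (by fun_prop) continuous_const, ?_⟩
    have : {z : Z₀ | z.1.1 = 0} = {z : Z₀ | z.1.1 < 1} := by
      ext ⟨z, hz⟩
      rcases hz with hz | hz <;> simp [hz]
    rw [this]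
    exact isOpen_lt (by fun_prop) continuous_const
  have hcont : Continuous fun z : Z₀ ↦
      if z.1.1 = 0 then (1 : G) else Ultrafilter.extend id z.1.2 := by
    refine continuous_if (fun a ha ↦ ?_) continuousOn_const
      (((continuous_ultrafilter_extend id).comp (by fun_prop)).continuousOn)
    rw [hclopen.frontier_eq] at ha
    exact ha.elim
  obtain ⟨h, hh⟩ := hG (I × Ultrafilter G) inferInstance inferInstance
    (covDimLE_one_unitInterval_prod _) Z₀ hZ₀ ⟨_, hcont⟩
  refine ⟨h, fun d ↦ ?_, fun d ↦ ?_⟩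
  · exact (hh ⟨(0, d), Or.inl rfl⟩).trans (if_pos rfl)
  · exact (hh ⟨(1, d), Or.inr rfl⟩).trans (if_neg one_ne_zero)

open unitInterval in
theorem IsAE.free_dual {G : Type u} [CommGroup G] [TopologicalSpace G] [IsTopologicalGroup G]
    [CompactSpace G] [T2Space G] (hG : IsAE 1 G) :
    Module.Free ℤ (Additive (G →ₜ* Circle)) := by
  obtain ⟨h, h0, h1⟩ := hG.exists_homotopy_ultrafilter
  let p : C(Ultrafilter G, G) := ⟨Ultrafilter.extend id, continuous_ultrafilter_extend id⟩
  have hp (d : Ultrafilter G) : h (1, d) = p d := h1 d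
  have hps : Function.Surjective p := fun x ↦ ⟨pure x, congrFun (ultrafilter_extend_extends id) x⟩
  have : PathConnectedSpace G := by
    have hj (x : G) : Joined 1 x := by
      obtain ⟨d, rfl⟩ := hps x
      exact ⟨⟨h.comp ⟨fun t ↦ (t, d), by fun_prop⟩, h0 d, hp d⟩⟩
    exact ⟨⟨1⟩, fun x y ↦ (hj x).symm.trans (hj y)⟩
  have hlift (χ : G →ₜ* Circle) (d : Ultrafilter G) :
      ((χ : C(G, Circle)).comp h) (0, d) = Circle.exp ((0 : C(Ultrafilter G, ℝ)) d) := by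
    change χ (h (0, d)) = Circle.exp 0
    rw [h0, map_one, Circle.exp_zero]
  let Λ (χ : G →ₜ* Circle) : C(I × Ultrafilter G, ℝ) :=
    Circle.isCoveringMap_exp.liftHomotopy ((χ : C(G, Circle)).comp h) 0 (hlift χ)
  have hΛ (χ : G →ₜ* Circle) (z) : Circle.exp (Λ χ z) = χ (h z) :=
    congrFun (Circle.isCoveringMap_exp.liftHomotopy_lifts _ _ (hlift χ)) z
  have hΛ0 (χ : G →ₜ* Circle) (d) : Λ χ (0, d) = 0 :=
    Circle.isCoveringMap_exp.liftHomotopy_zero _ _ (hlift χ) d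
  have hΛmul (χ ψ : G →ₜ* Circle) : Λ (χ * ψ) = Λ χ + Λ ψ := by
    refine ((Circle.isCoveringMap_exp.eq_liftHomotopy_iff' (hlift (χ * ψ)) _).2 ⟨?_, ?_⟩).symm
    · funext z
      change Circle.exp (Λ χ z + Λ ψ z) = χ (h z) * ψ (h z)
      rw [Circle.exp_add, hΛ, hΛ]
    · intro d
      change Λ χ (0, d) + Λ ψ (0, d) = 0
      rw [hΛ0, hΛ0, add_zero]
  let D' : Set (Ultrafilter G × Ultrafilter G) := {q | p q.1 = p q.2}
  have hD' : IsClosed D' := isClosed_eq (by fun_prop) (by fun_prop)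
  have : CompactSpace D' := isCompact_iff_compactSpace.1 hD'.isCompact
  have hm (χ : G →ₜ* Circle) (q : D') :
      ∃ m : ℤ, Λ χ (1, q.1.1) = Λ χ (1, q.1.2) + m * (2 * Real.pi) := by
    rw [← Circle.exp_eq_exp, hΛ, hΛ, hp, hp, q.2]
  choose m hm using hm
  have hm' (χ : G →ₜ* Circle) (q : D') :
      (m χ q : ℝ) = (Λ χ (1, q.1.1) - Λ χ (1, q.1.2)) / (2 * Real.pi) := by
    rw [hm χ q, add_sub_cancel_left, mul_div_cancel_right₀ _ Real.two_pi_pos.ne']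
  have hcont (χ : G →ₜ* Circle) : Continuous (m χ) := by
    rw [Int.isClosedEmbedding_coe_real.isEmbedding.continuous_iff]
    have : ((↑) : ℤ → ℝ) ∘ m χ =
        fun q : D' ↦ (Λ χ (1, q.1.1) - Λ χ (1, q.1.2)) / (2 * Real.pi) := funext (hm' χ)
    rw [this]
    fun_prop
  let δ : Additive (G →ₜ* Circle) →+ LocallyConstant D' ℤ := AddMonoidHom.mk'
    (fun χ ↦ ⟨m χ.toMul, (IsLocallyConstant.iff_continuous _).2 (hcont _)⟩) (by
      intro χ ψ
      ext q
      change m (χ.toMul * ψ.toMul) q = m χ.toMul q + m ψ.toMul q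
      have : (m (χ.toMul * ψ.toMul) q : ℝ) = m χ.toMul q + m ψ.toMul q := by
        rw [hm', hm', hm', hΛmul, ContinuousMap.add_apply, ContinuousMap.add_apply]
        ring
      exact_mod_cast this)
  have hδ : Function.Injective δ := by
    refine (injective_iff_map_eq_zero δ).2 fun χ hχ ↦ ?_
    have hq : IsQuotientMap p := p.continuous.isClosedMap.isQuotientMap p.continuous hps
    let g : C(Ultrafilter G, ℝ) := (Λ χ.toMul).comp ⟨fun d ↦ (1, d), by fun_prop⟩
    have hfac : Function.FactorsThrough g p := by
      intro a b hab
      have h2 := hm χ.toMul ⟨(a, b), hab⟩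
      have h3 : m χ.toMul ⟨(a, b), hab⟩ = 0 := DFunLike.congr_fun hχ _
      rw [h3, Int.cast_zero, zero_mul, add_zero] at h2
      exact h2
    let f : C(G, ℝ) := hq.lift g hfac
    have hf (d) : f (p d) = Λ χ.toMul (1, d) := DFunLike.congr_fun (hq.lift_comp g hfac) d
    refine Additive.toMul.injective (ContinuousMonoidHom.eq_one_of_exp_lift χ.toMul f fun x ↦ ?_)
    obtain ⟨d, rfl⟩ := hps x
    rw [hf, hΛ, hp]
  have hfree : Module.Free ℤ (LocallyConstant D' ℤ) :=
    LocallyConstant.freeOfProfinite (Profinite.of D')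
  exact Module.Free.of_injective_of_pid δ.toIntLinearMap hδ

theorem CStarAlgebra.exists_starAlgHom_ne_zero {A : Type*} [CommCStarAlgebra A] {a : A}
    (ha : a ≠ 0) : ∃ φ : A →⋆ₐ[ℂ] ℂ, Continuous φ ∧ φ a ≠ 0 := by
  by_contra! h
  refine ha ((map_eq_zero_iff _ (gelfandTransform_isometry A).injective).1 ?_)
  ext φ
  exact h (φ : A →⋆ₐ[ℂ] ℂ) (map_continuous φ)

open StarAlgebra StarSubalgebra in
theorem StarAlgebra.exists_starAlgHom_ne_zero {A : Type*} [CStarAlgebra A] {s : Set A}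
    (hcomm : ∀ x ∈ s, ∀ y ∈ s, x * y = y * x)
    (hcomm_star : ∀ x ∈ s, ∀ y ∈ s, x * star y = star y * x) :
    ∀ a : (adjoin ℂ s).topologicalClosure, a ≠ 0 →
      ∃ φ : (adjoin ℂ s).topologicalClosure →⋆ₐ[ℂ] ℂ, Continuous φ ∧ φ a ≠ 0 := by
  intro a ha
  have hS : IsClosed ((adjoin ℂ s).topologicalClosure : Set A) :=
    (adjoin ℂ s).isClosed_topologicalClosure
  have := isMulCommutative_adjoin ℂ hcomm hcomm_star
  let i : CStarAlgebra (adjoin ℂ s).topologicalClosure := inferInstance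
  let _ : CommCStarAlgebra (adjoin ℂ s).topologicalClosure :=
    { i with mul_comm := ((adjoin ℂ s).commRingTopologicalClosure fun x y ↦ mul_comm' x y).mul_comm }
  exact CStarAlgebra.exists_starAlgHom_ne_zero ha

open MeasureTheory in
/-- The operator `v ↦ ∫ f z • U z v ∂μ` as a function of `f`. -/
noncomputable def integralOperator {G : Type*} [TopologicalSpace G] [CompactSpace G]
    [MeasurableSpace G] [BorelSpace G] (μ : Measure G) [IsProbabilityMeasure μ]
    {H : Type*} [NormedAddCommGroup H] [NormedSpace ℂ H] (U : G → H →L[ℂ] H)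
    (hU : ∀ y v, ‖U y v‖ = ‖v‖) (hc : ∀ v, Continuous fun y ↦ U y v) :
    C(G, ℂ) →L[ℂ] H →L[ℂ] H :=
  have hint (f : C(G, ℂ)) (v : H) : Integrable (fun z ↦ f z • U z v) μ :=
    Continuous.integrable_of_hasCompactSupport (f.continuous.smul (hc v))
      (HasCompactSupport.of_compactSpace _)
  LinearMap.mkContinuous₂ (LinearMap.mk₂ ℂ (fun f v ↦ ∫ z, f z • U z v ∂μ)
    (fun f g v ↦ by
      simp only [ContinuousMap.add_apply, add_smul]
      exact integral_add (hint f v) (hint g v))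
    (fun c f v ↦ by
      simp only [ContinuousMap.smul_apply, smul_assoc]
      exact integral_smul _ _)
    (fun f v w ↦ by
      simp only [map_add, smul_add]
      exact integral_add (hint f v) (hint f w))
    (fun c f v ↦ by
      simp only [map_smul, smul_comm _ c]
      exact integral_smul _ _)) 1 fun f v ↦ by
        have : ∀ᵐ z ∂μ, ‖f z • U z v‖ ≤ ‖f‖ * ‖v‖ := .of_forall fun z ↦ by
          rw [norm_smul, hU]
          gcongr
          exact f.norm_coe_le_norm z
        simpa using norm_integral_le_of_norm_le_const this

open MeasureTheory in
theorem integralOperator_apply {G : Type*} [TopologicalSpace G] [CompactSpace G]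
    [MeasurableSpace G] [BorelSpace G] (μ : Measure G) [IsProbabilityMeasure μ]
    {H : Type*} [NormedAddCommGroup H] [NormedSpace ℂ H] (U : G → H →L[ℂ] H)
    (hU : ∀ y v, ‖U y v‖ = ‖v‖) (hc : ∀ v, Continuous fun y ↦ U y v) (f : C(G, ℂ)) (v : H) :
    integralOperator μ U hU hc f v = ∫ z, f z • U z v ∂μ := rfl

open MeasureTheory ComplexConjugate in
open scoped InnerProductSpace in
theorem exists_continuousMonoidHom_circle_of_unitary_rep {G : Type*} [CommGroup G]
    [TopologicalSpace G] [IsTopologicalGroup G] [CompactSpace G]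
    {H : Type*} [NormedAddCommGroup H] [InnerProductSpace ℂ H] [CompleteSpace H]
    (U : G →* H →L[ℂ] H) (hU : ∀ y v, ‖U y v‖ = ‖v‖) (hc : ∀ v, Continuous fun y ↦ U y v)
    {x : G} {v : H} (hx : U x v ≠ v) : ∃ χ : G →ₜ* Circle, χ x ≠ 1 := by
  borelize G
  let μ : Measure G := Measure.haarMeasure ⊤
  have hμ : IsProbabilityMeasure μ := ⟨by
    simpa using Measure.haarMeasure_self (K₀ := (⊤ : TopologicalSpace.PositiveCompacts G))⟩
  have hstar (y : G) : star (U y) * U y = 1 :=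
    (ContinuousLinearMap.norm_map_iff_adjoint_comp_self (U y)).1 (hU y)
  have hmul (y z : G) : U y * U z = U z * U y := by rw [← map_mul, mul_comm, map_mul]
  have hstar' (y : G) : star (U y) = U y⁻¹ := by
    calc star (U y) = star (U y) * (U y * U y⁻¹) := by rw [← map_mul]; simp
      _ = U y⁻¹ := by rw [← mul_assoc, hstar, one_mul]
  let w := U x v - v
  have hw : w ≠ 0 := sub_ne_zero.2 hx
  let Φ := integralOperator μ U hU hc
  have hint (f : C(G, ℂ)) (v : H) : Integrable (fun z ↦ f z • U z v) μ :=
    Continuous.integrable_of_hasCompactSupport (f.continuous.smul (hc v))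
      (HasCompactSupport.of_compactSpace _)
  have hcommΦ (f : C(G, ℂ)) (S : H →L[ℂ] H) (hS : ∀ y, S * U y = U y * S) : S * Φ f = Φ f * S := by
    ext u
    change S (Φ f u) = Φ f (S u)
    rw [integralOperator_apply, integralOperator_apply, ← S.integral_comp_comm (hint f u)]
    congr 1 with z
    rw [map_smul]
    congr 1
    exact DFunLike.congr_fun (hS z) u
  let f : C(G, ℂ) := ⟨fun z ↦ ⟪U z w, w⟫_ℂ, (hc w).inner continuous_const⟩
  let T := Φ f
  have hTw : T w ≠ 0 := by
    intro h0
    have h1 : ⟪w, T w⟫_ℂ = ((∫ z, ‖f z‖ ^ 2 ∂μ : ℝ) : ℂ) := by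
      rw [integralOperator_apply]
      change innerSL ℂ w _ = _
      rw [← ContinuousLinearMap.integral_comp_comm _ (hint f w), ← integral_complex_ofReal]
      congr 1 with z
      rw [map_smul, smul_eq_mul]
      change ⟪U z w, w⟫_ℂ * ⟪w, U z w⟫_ℂ = _
      rw [← inner_conj_symm w (U z w), Complex.mul_conj, Complex.normSq_eq_norm_sq]
      rfl
    rw [h0, inner_zero_right, eq_comm, Complex.ofReal_eq_zero] at h1
    have h2 : Continuous fun z ↦ ‖f z‖ ^ 2 := by fun_prop
    have h3 : 0 < ∫ z, ‖f z‖ ^ 2 ∂μ := by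
      refine h2.integral_pos_of_hasCompactSupport_nonneg_nonzero
        (HasCompactSupport.of_compactSpace _) (fun z ↦ by positivity) (x := 1) ?_
      change ‖⟪U 1 w, w⟫_ℂ‖ ^ 2 ≠ 0
      simpa using hw
    exact h3.ne' h1
  have hUT (y : G) : U y * T = T * U y := hcommΦ f _ fun z ↦ hmul y z
  have hUT' (y : G) : star (U y) * T = T * star (U y) := by rw [hstar', hUT]
  have hTs (y : G) : star T * U y = U y * star T := by
    have := congrArg star (hUT' y)
    simpa using this
  have hTT : star T * T = T * star T := hcommΦ f _ hTs
  let s : Set (H →L[ℂ] H) := insert T (Set.range U)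
  have hcomm : ∀ a ∈ s, ∀ b ∈ s, a * b = b * a := by
    rintro _ (rfl | ⟨y, rfl⟩) _ (rfl | ⟨z, rfl⟩)
    exacts [rfl, (hUT z).symm, hUT y, hmul y z]
  have hcomm_star : ∀ a ∈ s, ∀ b ∈ s, a * star b = star b * a := by
    rintro _ (rfl | ⟨y, rfl⟩) _ (rfl | ⟨z, rfl⟩)
    · exact hTT.symm
    · exact (hUT' z).symm
    · exact (hTs y).symm
    · rw [hstar', hmul]
  let B := (StarAlgebra.adjoin ℂ s).topologicalClosure
  have hsB {a} (ha : a ∈ s) : a ∈ B :=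
    (StarAlgebra.adjoin ℂ s).le_topologicalClosure (StarAlgebra.subset_adjoin ℂ s ha)
  let t : B := ⟨T, hsB (Set.mem_insert _ _)⟩
  let u : G →* B :=
    { toFun y := ⟨U y, hsB (Set.mem_insert_of_mem _ ⟨y, rfl⟩)⟩
      map_one' := Subtype.ext (map_one U)
      map_mul' y z := Subtype.ext (map_mul U y z) }
  have hne : (u x - 1) * t ≠ 0 := by
    intro h
    have h1 : (U x - 1) * T = 0 := congrArg Subtype.val h
    rw [sub_mul, hUT, one_mul, sub_eq_zero] at h1
    refine hTw ?_
    change T (U x v - v) = 0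
    rw [map_sub, sub_eq_zero]
    exact DFunLike.congr_fun h1 v
  obtain ⟨φ, hφ, hφ0⟩ := StarAlgebra.exists_starAlgHom_ne_zero hcomm hcomm_star _ hne
  rw [map_mul, map_sub, map_one] at hφ0
  have ht : φ t ≠ 0 := right_ne_zero_of_mul hφ0
  have hx1 : φ (u x) ≠ 1 := sub_ne_zero.1 (left_ne_zero_of_mul hφ0)
  have hnorm (y : G) : φ (u y) ∈ unitary ℂ := by
    have h1 : star (u y) * u y = 1 := Subtype.ext (hstar y)
    have h2 : star (φ (u y)) * φ (u y) = 1 := by rw [← map_star, ← map_mul, h1, map_one]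
    exact ⟨h2, by rw [mul_comm, h2]⟩
  have hcont : Continuous fun y ↦ φ (u y) := by
    let F : C(G × G, ℂ) := ⟨fun q ↦ f (q.1⁻¹ * q.2), by fun_prop⟩
    have h1 : Continuous fun y ↦ U y * T := by
      have : (fun y ↦ U y * T) = fun y ↦ Φ (F.curry y) := by
        funext y
        ext a
        change U y (T a) = Φ (F.curry y) a
        rw [integralOperator_apply, integralOperator_apply,
          ← (U y).integral_comp_comm (hint f a),
          ← integral_mul_left_eq_self (fun z ↦ F.curry y z • U z a) y]
        congr 1 with z
        rw [map_smul]
        change f z • (U y * U z) a = f (y⁻¹ * (y * z)) • U (y * z) a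
        rw [inv_mul_cancel_left, map_mul U]
      rw [this]
      exact Φ.continuous.comp F.curry.continuous
    have h2 : Continuous fun y ↦ u y * t := h1.subtype_mk _
    have h3 : (fun y ↦ φ (u y)) = fun y ↦ φ (u y * t) / φ t := by
      funext y
      rw [map_mul, mul_div_cancel_right₀ _ ht]
    rw [h3]
    exact (hφ.comp h2).div_const _
  have hcirc (y : G) : φ (u y) ∈ Submonoid.unitSphere ℂ :=
    mem_sphere_zero_iff_norm.2 (CStarRing.norm_of_mem_unitary (hnorm y))
  refine ⟨⟨⟨⟨fun y ↦ ⟨φ (u y), hcirc y⟩, ?_⟩, ?_⟩, ?_⟩, ?_⟩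
  · exact Circle.ext (by simp)
  · exact fun y z ↦ Circle.ext ((congrArg φ (map_mul u y z)).trans (map_mul φ _ _))
  · exact hcont.subtype_mk _
  · exact fun h ↦ hx1 (congrArg Subtype.val h)

open MeasureTheory in
theorem exists_continuousMonoidHom_circle_ne_one {G : Type*} [CommGroup G] [TopologicalSpace G]
    [IsTopologicalGroup G] [CompactSpace G] [T2Space G] {x : G} (hx : x ≠ 1) :
    ∃ χ : G →ₜ* Circle, χ x ≠ 1 := by
  borelize G
  let μ : Measure G := Measure.haarMeasure ⊤
  let U : G →* Lp ℂ 2 μ →L[ℂ] Lp ℂ 2 μ :=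
    { toFun y := LinearMap.mkContinuous
        { toFun v := DomMulAct.mk y • v
          map_add' := DomMulAct.smul_Lp_add _
          map_smul' c v := smul_comm _ c v } 1 fun v ↦ by
            rw [one_mul]; exact (DomMulAct.norm_smul_Lp _ v).le
      map_one' := by
        ext1 v
        exact one_smul Gᵈᵐᵃ v
      map_mul' y z := by
        ext1 v
        change DomMulAct.mk (y * z) • v = DomMulAct.mk y • DomMulAct.mk z • v
        rw [smul_smul, ← DomMulAct.mk_mul, mul_comm] }
  have hUapp (y : G) (v : Lp ℂ 2 μ) : U y v = DomMulAct.mk y • v := rfl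
  obtain ⟨g, hg0, hg1, -⟩ := exists_continuous_zero_one_of_isClosed
    (isClosed_singleton (x := x)) (isClosed_singleton (x := (1 : G)))
    (by simpa using hx)
  let g' : C(G, ℂ) := ⟨fun z ↦ g z, by fun_prop⟩
  refine exists_continuousMonoidHom_circle_of_unitary_rep U
    (fun y v ↦ DomMulAct.norm_smul_Lp _ v) (fun v ↦ ?_)
    (x := x) (v := ContinuousMap.toLp 2 μ ℂ g') fun h ↦ ?_
  · have : Fact ((2 : ENNReal) ≠ ⊤) := ⟨by simp⟩
    have : μ.InnerRegularCompactLTTop := inferInstance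
    have : ContinuousSMul Gᵈᵐᵃ (Lp ℂ 2 μ) := inferInstance
    simp only [hUapp]
    exact (DomMulAct.continuous_mk).smul continuous_const
  · have h1 : U x (ContinuousMap.toLp 2 μ ℂ g') =
        ContinuousMap.toLp 2 μ ℂ (g'.comp ⟨fun z ↦ x * z, by fun_prop⟩) := rfl
    rw [h1] at h
    have h2 := DFunLike.congr_fun (ContinuousMap.toLp_injective μ h) 1
    simp [g', hg0 rfl, hg1 rfl] at h2

open MeasureTheory in
theorem ContinuousMonoidHom.integral_coe_eq_zero {G : Type*} [Group G] [TopologicalSpace G]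
    [IsTopologicalGroup G] [MeasurableSpace G] [BorelSpace G] (μ : Measure G)
    [μ.IsMulLeftInvariant] {χ : G →ₜ* Circle} (hχ : χ ≠ 1) : ∫ g, (χ g : ℂ) ∂μ = 0 := by
  obtain ⟨x, hx⟩ : ∃ x, χ x ≠ 1 := by
    by_contra! h
    exact hχ (ContinuousMonoidHom.ext h)
  have h1 : ∫ g, (χ g : ℂ) ∂μ = χ x * ∫ g, (χ g : ℂ) ∂μ := by
    rw [← integral_const_mul, ← integral_mul_left_eq_self _ x]
    simp
  have h2 : (χ x : ℂ) ≠ 1 := fun h ↦ hx (Circle.ext h)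
  by_contra h0
  exact h2 (mul_right_cancel₀ h0 (by rw [one_mul, ← h1]))

open MeasureTheory in
theorem ContinuousMap.continuous_integral {G : Type*} [TopologicalSpace G] [CompactSpace G]
    [MeasurableSpace G] [BorelSpace G] (μ : Measure G) [IsProbabilityMeasure μ] :
    Continuous fun f : C(G, ℂ) ↦ ∫ z, f z ∂μ := by
  let Φ := integralOperator μ (fun _ ↦ ContinuousLinearMap.id ℂ ℂ) (fun _ _ ↦ rfl)
    (fun _ ↦ continuous_const)
  have : (fun f : C(G, ℂ) ↦ ∫ z, f z ∂μ) = fun f ↦ Φ f 1 := by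
    funext f
    exact (integral_congr_ae (.of_forall fun z ↦ (mul_one (f z)).symm))
  rw [this]
  fun_prop

open MeasureTheory in
/-- If `D` is a point-separating group of characters of `K` which injects into the dual of `G`
under composition with `π`, then `π` pushes Haar measure to Haar measure, hence is surjective. -/
theorem ContinuousMonoidHom.surjective_of_injOn_comp {G K : Type*}
    [Group G] [TopologicalSpace G] [IsTopologicalGroup G] [CompactSpace G]
    [Group K] [TopologicalSpace K] [IsTopologicalGroup K] [CompactSpace K] [T2Space K]
    (π : G →ₜ* K) (D : Subgroup (K →ₜ* Circle))
    (hsep : ∀ x y : K, x ≠ y → ∃ χ ∈ D, χ x ≠ χ y)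
    (hD : ∀ χ ∈ D, χ.comp π = 1 → χ = 1) : Function.Surjective π := by
  borelize G K
  let μ : Measure G := Measure.haarMeasure ⊤
  have hμ : IsProbabilityMeasure μ := ⟨by
    simpa using Measure.haarMeasure_self (K₀ := (⊤ : TopologicalSpace.PositiveCompacts G))⟩
  let ν : Measure K := Measure.haarMeasure ⊤
  have hν : IsProbabilityMeasure ν := ⟨by
    simpa using Measure.haarMeasure_self (K₀ := (⊤ : TopologicalSpace.PositiveCompacts K))⟩
  let π' : C(G, K) := π
  let ev (χ : K →ₜ* Circle) : C(K, ℂ) := ⟨fun x ↦ χ x, by fun_prop⟩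
  let S : Submonoid C(K, ℂ) :=
    { carrier := {f | ∃ χ ∈ D, ev χ = f}
      one_mem' := ⟨1, D.one_mem, rfl⟩
      mul_mem' := by
        rintro _ _ ⟨χ, hχ, rfl⟩ ⟨ψ, hψ, rfl⟩
        exact ⟨χ * ψ, D.mul_mem hχ hψ, rfl⟩ }
  have hSstar : star (S : Set C(K, ℂ)) ⊆ S := by
    rintro f ⟨χ, hχ, h⟩
    refine ⟨χ⁻¹, D.inv_mem hχ, ?_⟩
    rw [← star_star f, ← h]
    ext x
    exact Circle.coe_inv_eq_conj (χ x)
  let A := StarAlgebra.adjoin ℂ (S : Set C(K, ℂ))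
  have hA : (A : Set C(K, ℂ)) ⊆ Submodule.span ℂ (S : Set C(K, ℂ)) := by
    intro f hf
    have h1 : f ∈ Algebra.adjoin ℂ ((S : Set C(K, ℂ)) ∪ star (S : Set C(K, ℂ))) := hf
    rw [Set.union_eq_self_of_subset_right hSstar, ← Subalgebra.mem_toSubmodule,
      Algebra.adjoin_eq_span, Submonoid.closure_eq] at h1
    exact h1
  have hAtop : A.topologicalClosure = ⊤ := by
    refine ContinuousMap.starSubalgebra_topologicalClosure_eq_top_of_separatesPoints A ?_
    intro x y hxy
    obtain ⟨χ, hχ, h⟩ := hsep x y hxy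
    exact ⟨ev χ, ⟨ev χ, StarAlgebra.subset_adjoin ℂ _ ⟨χ, hχ, rfl⟩, rfl⟩,
      fun h' ↦ h (Circle.ext h')⟩
  have hclosed : IsClosed {f : C(K, ℂ) | ∫ x, f x ∂ν = ∫ g, f.comp π' g ∂μ} :=
    isClosed_eq (ContinuousMap.continuous_integral ν)
      ((ContinuousMap.continuous_integral μ).comp (ContinuousMap.continuous_precomp π'))
  have hintν (f : C(K, ℂ)) : Integrable f ν :=
    f.continuous.integrable_of_hasCompactSupport (HasCompactSupport.of_compactSpace _)
  have hintμ (f : C(G, ℂ)) : Integrable f μ :=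
    f.continuous.integrable_of_hasCompactSupport (HasCompactSupport.of_compactSpace _)
  have hspan (f : C(K, ℂ)) (hf : f ∈ Submodule.span ℂ (S : Set C(K, ℂ))) :
      ∫ x, f x ∂ν = ∫ g, f.comp π' g ∂μ := by
    induction hf using Submodule.span_induction with
    | mem f hf =>
      obtain ⟨χ, hχ, rfl⟩ := hf
      by_cases h1 : χ = 1
      · subst h1
        simp [ev]
      · exact (ContinuousMonoidHom.integral_coe_eq_zero ν h1).trans
          (ContinuousMonoidHom.integral_coe_eq_zero μ fun h ↦ h1 (hD χ hχ h)).symm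
    | zero => simp
    | add f g _ _ hf hg =>
      have h1 : ∫ x, (f + g) x ∂ν = ∫ x, f x ∂ν + ∫ x, g x ∂ν := integral_add (hintν f) (hintν g)
      have h2 : ∫ x, (f + g).comp π' x ∂μ = ∫ x, f.comp π' x ∂μ + ∫ x, g.comp π' x ∂μ :=
        integral_add (hintμ (f.comp π')) (hintμ (g.comp π'))
      rw [h1, h2, hf, hg]
    | smul c f _ hf =>
      have h1 : ∫ x, (c • f) x ∂ν = c • ∫ x, f x ∂ν := integral_smul c _
      have h2 : ∫ x, (c • f).comp π' x ∂μ = c • ∫ x, f.comp π' x ∂μ := integral_smul c _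
      rw [h1, h2, hf]
  have hall (f : C(K, ℂ)) : ∫ x, f x ∂ν = ∫ g, f.comp π' g ∂μ := by
    have h1 : f ∈ A.topologicalClosure := hAtop ▸ trivial
    exact closure_minimal (fun f hf ↦ hspan f (hA hf)) hclosed h1
  intro y
  by_contra hy
  obtain ⟨f, hf0, hf1, hf⟩ := exists_continuous_zero_one_of_isClosed
    (isCompact_range π'.continuous).isClosed (isClosed_singleton (x := y))
    (Set.disjoint_singleton_right.2 hy)
  have hpos : 0 < ∫ x, f x ∂ν :=
    f.continuous.integral_pos_of_hasCompactSupport_nonneg_nonzero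
      (HasCompactSupport.of_compactSpace _) (fun z ↦ (hf z).1) (x := y) (by simp [hf1 rfl])
  have h1 := hall ⟨fun x ↦ f x, by fun_prop⟩
  have h2 (g : G) : f (π' g) = 0 := hf0 ⟨g, rfl⟩
  simp only [ContinuousMap.coe_mk, ContinuousMap.comp_apply, h2, Complex.ofReal_zero,
    integral_zero, integral_complex_ofReal, Complex.ofReal_eq_zero] at h1
  exact hpos.ne' h1

theorem exists_isTopGroupIso_pi_circle_of_basis {G : Type*} [CommGroup G] [TopologicalSpace G]
    [IsTopologicalGroup G] [CompactSpace G] [T2Space G] {T : Type*}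
    (b : Module.Basis T ℤ (Additive (G →ₜ* Circle))) :
    ∃ e : G ≃* (T → Circle), IsTopGroupIso e := by
  let π : G →ₜ* (T → Circle) :=
    { toFun g t := (b t).toMul g
      map_one' := funext fun t ↦ map_one _
      map_mul' x y := funext fun t ↦ map_mul _ x y
      continuous_toFun := by fun_prop }
  have hinj : Function.Injective π := by
    refine (injective_iff_map_eq_one π).2 fun x hx ↦ ?_
    by_contra h
    obtain ⟨χ, hχ⟩ := exists_continuousMonoidHom_circle_ne_one h
    let E : Additive (G →ₜ* Circle) →+ Additive Circle :=
      { toFun χ := Additive.ofMul (χ.toMul x)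
        map_zero' := rfl
        map_add' _ _ := rfl }
    have hE : E.toIntLinearMap = 0 := b.ext fun t ↦ congrArg Additive.ofMul (congrFun hx t)
    exact hχ (congrArg Additive.toMul (DFunLike.congr_fun hE (Additive.ofMul χ)))
  let P : Additive ((T → Circle) →ₜ* Circle) →+ Additive (G →ₜ* Circle) :=
    { toFun χ := Additive.ofMul (χ.toMul.comp π)
      map_zero' := rfl
      map_add' _ _ := rfl }
  let p (t : T) : (T → Circle) →ₜ* Circle := ⟨Pi.evalMonoidHom _ t, continuous_apply t⟩
  let L := Finsupp.linearCombination ℤ fun t ↦ Additive.ofMul (p t)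
  have hL (n : T →₀ ℤ) : P (L n) = Finsupp.linearCombination ℤ b n := by
    change (P.toIntLinearMap ∘ₗ L) n = _
    congr 1
    ext t
    simp [L]
    rfl
  have hsurj : Function.Surjective π := by
    refine π.surjective_of_injOn_comp
      (AddSubgroup.toSubgroup' (LinearMap.range L).toAddSubgroup) (fun x y hxy ↦ ?_) ?_
    · obtain ⟨t, ht⟩ := Function.ne_iff.1 hxy
      exact ⟨p t, ⟨Finsupp.single t 1, by simp [L]; rfl⟩, ht⟩
    · rintro χ ⟨n, hn⟩ hχ
      have h1 : P (L n) = 0 := by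
        rw [hn]
        exact congrArg Additive.ofMul hχ
      rw [hL] at h1
      have h2 : n = 0 := b.linearIndependent (h1.trans (map_zero _).symm)
      rw [h2, map_zero] at hn
      exact congrArg Additive.toMul hn.symm
  let e : G ≃* (T → Circle) := MulEquiv.ofBijective π ⟨hinj, hsurj⟩
  have he : Continuous e := π.continuous_toFun
  exact ⟨e, he, he.continuous_symm_of_equiv_compact_to_t2 (f := e.toEquiv)⟩

/-- **Theorem B.** A compact Hausdorff abelian topological group `G` is an
AE(1)-compactum if and only if `G` is a torus, i.e. isomorphic as a topological
group to a product of copies of the circle group. -/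
theorem compact_abelian_group_AE1_iff_torus
    (G : Type u) [CommGroup G] [TopologicalSpace G] [IsTopologicalGroup G]
    [CompactSpace G] [T2Space G] :
    IsAE 1 G ↔ ∃ (T : Type u) (e : G ≃* (T → Circle)), IsTopGroupIso e := by
  refine ⟨fun h ↦ ?_, fun ⟨T, e, he⟩ ↦ isAE_one_of_torus e he⟩
  have := h.free_dual
  obtain ⟨e, he⟩ := exists_isTopGroupIso_pi_circle_of_basis
    (Module.Free.chooseBasis ℤ (Additive (G →ₜ* Circle)))
  exact ⟨_, e, he⟩
end
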